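/- Let I' ⊂ S' = K[x_1,…,x_{n−1}] be a nonzero proper monomial ideal and let I = (I', x_n) ⊂ S = K[x_1,…,x_n] be the ideal generated by I' and the variable x_n. Then slength(I) = slength(I') + 1. -/

import Mathlib

open MvPolynomial

/-- The set of exponent vectors of the monomials in the Stanley space `x^u · K[Z]`. -/
def stanleySet {σ : Type} (u : σ →₀ ℕ) (Z : Set σ) : Set (σ →₀ ℕ) :=
  {w | ∃ v : σ →₀ ℕ, ↑v.support ⊆ Z ∧ w = u + v}

/-- A Stanley decomposition (partition into Stanley spaces) of a set `P` of
exponent vectors of monomials.  By the standard correspondence, Stanley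
decompositions of a multigraded `K`-vector subquotient of `S` spanned by the
monomials with exponents in `P` correspond exactly to such partitions. -/
structure StanleyPartition {σ : Type} (P : Set (σ →₀ ℕ)) where
  r : ℕ
  base : Fin r → σ →₀ ℕ
  vars : Fin r → Set σ
  cover : P = ⋃ i, stanleySet (base i) (vars i)
  disj : ∀ i j, i ≠ j → Disjoint (stanleySet (base i) (vars i)) (stanleySet (base j) (vars j))

/-- The Stanley length of `P`: the minimal length of a Stanley decomposition. -/
noncomputable def slength {σ : Type} (P : Set (σ →₀ ℕ)) : ℕ :=
  sInf {r | ∃ D : StanleyPartition P, D.r = r}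

/-- The set of exponent vectors of the monomials belonging to an ideal. -/
def monSet {σ K : Type} [Field K] (I : Ideal (MvPolynomial σ K)) : Set (σ →₀ ℕ) :=
  {d | (monomial d (1 : K) : MvPolynomial σ K) ∈ I}

/-- `I` is a monomial ideal. -/
def IsMonomialIdeal {σ K : Type} [Field K] (I : Ideal (MvPolynomial σ K)) : Prop :=
  ∃ A : Set (σ →₀ ℕ), I = Ideal.span ((fun d => (monomial d (1 : K) : MvPolynomial σ K)) '' A)

/-- Exponent vectors of the minimal monomial generators of `I`. -/
def minGens {σ K : Type} [Field K] (I : Ideal (MvPolynomial σ K)) : Set (σ →₀ ℕ) :=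
  {d | d ∈ monSet I ∧ ∀ e ∈ monSet I, e ≤ d → e = d}

theorem mem_stanleySet_iff {σ : Type} {u w : σ →₀ ℕ} {Z : Set σ} :
    w ∈ stanleySet u Z ↔ u ≤ w ∧ ∀ i ∉ Z, w i = u i := by
  constructor
  · rintro ⟨v, hv, rfl⟩
    refine ⟨le_self_add, fun i hi => ?_⟩
    have : v i = 0 := by
      by_contra h
      exact hi (hv (Finsupp.mem_support_iff.2 h))
    simp [this]
  · rintro ⟨hle, h⟩
    refine ⟨w - u, fun i hi => ?_, (add_tsub_cancel_of_le hle).symm⟩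
    by_contra hZ
    simp [h i hZ] at hi

theorem base_mem_stanleySet {σ : Type} (u : σ →₀ ℕ) (Z : Set σ) : u ∈ stanleySet u Z :=
  mem_stanleySet_iff.2 ⟨le_rfl, fun _ _ => rfl⟩

/-- A Stanley partition indexed by an arbitrary finite type. -/
theorem exists_stanleyPartition_of_fintype {σ ι : Type} [Fintype ι] {P : Set (σ →₀ ℕ)}
    (base : ι → σ →₀ ℕ) (vars : ι → Set σ)
    (cover : ∀ w, w ∈ P ↔ ∃ i, w ∈ stanleySet (base i) (vars i))
    (disj : ∀ i j w, w ∈ stanleySet (base i) (vars i) → w ∈ stanleySet (base j) (vars j) →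
      i = j) :
    ∃ D : StanleyPartition P, D.r = Fintype.card ι := by
  let e := (Fintype.equivFin ι).symm
  refine ⟨⟨Fintype.card ι, base ∘ e, vars ∘ e, ?_, ?_⟩, rfl⟩
  · ext w
    rw [cover, Set.mem_iUnion]
    exact (e.surjective.exists (p := fun i => w ∈ stanleySet (base i) (vars i)))
  · intro i j hij
    rw [Set.disjoint_left]
    exact fun w hi hj => hij (e.injective (disj _ _ w hi hj))

namespace StanleyPartition

variable {σ : Type} {P : Set (σ →₀ ℕ)}

theorem mem_iff (D : StanleyPartition P) (w : σ →₀ ℕ) :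
    w ∈ P ↔ ∃ i, w ∈ stanleySet (D.base i) (D.vars i) := by
  conv_lhs => rw [D.cover]
  exact Set.mem_iUnion

theorem eq_of_mem (D : StanleyPartition P) {i j : Fin D.r} {w : σ →₀ ℕ}
    (hi : w ∈ stanleySet (D.base i) (D.vars i)) (hj : w ∈ stanleySet (D.base j) (D.vars j)) :
    i = j := by
  by_contra h
  exact Set.disjoint_left.1 (D.disj i j h) hi hj

theorem slength_le (D : StanleyPartition P) : slength P ≤ D.r :=
  Nat.sInf_le ⟨D, rfl⟩

theorem exists_r_eq_slength (D : StanleyPartition P) :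
    ∃ E : StanleyPartition P, E.r = slength P :=
  Nat.sInf_mem (s := {r | ∃ D : StanleyPartition P, D.r = r}) ⟨D.r, D, rfl⟩

end StanleyPartition

/-- The exponent vector `u` extended by the last exponent `b`. -/
noncomputable def expSnoc {n : ℕ} (u : Fin n →₀ ℕ) (b : ℕ) : Fin (n + 1) →₀ ℕ :=
  Finsupp.equivFunOnFinite.symm (Fin.snoc (α := fun _ => ℕ) u b)

/-- The exponent vector `w` with its last exponent dropped. -/
noncomputable def expInit {n : ℕ} (w : Fin (n + 1) →₀ ℕ) : Fin n →₀ ℕ :=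
  Finsupp.equivFunOnFinite.symm fun i => w i.castSucc

section Exponents

variable {n : ℕ}

@[simp] theorem expSnoc_castSucc (u : Fin n →₀ ℕ) (b : ℕ) (i : Fin n) :
    expSnoc u b i.castSucc = u i := by
  simp [expSnoc]

@[simp] theorem expSnoc_last (u : Fin n →₀ ℕ) (b : ℕ) : expSnoc u b (Fin.last n) = b := by
  simp [expSnoc]

@[simp] theorem expInit_apply (w : Fin (n + 1) →₀ ℕ) (i : Fin n) :
    expInit w i = w i.castSucc := rfl

@[simp] theorem expInit_expSnoc (u : Fin n →₀ ℕ) (b : ℕ) : expInit (expSnoc u b) = u := by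
  ext; simp

theorem le_iff_expInit_le_and_last_le {v w : Fin (n + 1) →₀ ℕ} :
    v ≤ w ↔ expInit v ≤ expInit w ∧ v (Fin.last n) ≤ w (Fin.last n) := by
  simp only [Finsupp.le_def, Fin.forall_fin_succ', expInit_apply]

@[simp] theorem expSnoc_expInit (w : Fin (n + 1) →₀ ℕ) :
    expSnoc (expInit w) (w (Fin.last n)) = w := by
  ext i
  induction i using Fin.lastCases <;> simp

theorem mem_stanleySet_iff_expInit {u w : Fin (n + 1) →₀ ℕ} {Z : Set (Fin (n + 1))} :
    w ∈ stanleySet u Z ↔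
      expInit w ∈ stanleySet (expInit u) (Fin.castSucc ⁻¹' Z) ∧
        u (Fin.last n) ≤ w (Fin.last n) ∧
        (Fin.last n ∉ Z → w (Fin.last n) = u (Fin.last n)) := by
  simp only [mem_stanleySet_iff, le_iff_expInit_le_and_last_le (n := n), Fin.forall_fin_succ',
    expInit_apply, Set.mem_preimage]
  tauto

/-- The slices of an upward closed set of exponent vectors stabilize. -/
theorem IsUpperSet.exists_expSnoc_stable {P : Set (Fin (n + 1) →₀ ℕ)} (hP : IsUpperSet P) :
    ∃ N, ∀ b, ∀ c, expSnoc c b ∈ P → expSnoc c N ∈ P := by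
  have hfin : {d | Minimal (· ∈ P) d}.Finite :=
    WellQuasiOrderedLE.finite_of_isAntichain (setOfPred_minimal_antichain _)
  obtain ⟨N, hN⟩ := (hfin.image fun d => d (Fin.last n)).bddAbove
  refine ⟨N, fun b c hc => ?_⟩
  obtain ⟨m, hm, hmin⟩ := exists_minimal_le_of_wellFoundedLT (· ∈ P) _ hc
  refine hP ?_ hmin.prop
  rw [le_iff_expInit_le_and_last_le] at hm ⊢
  simp only [expInit_expSnoc, expSnoc_last] at hm ⊢
  exact ⟨hm.1, hN ⟨m, hmin, rfl⟩⟩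

theorem IsUpperSet.nonempty_stanleyPartition {n : ℕ} {P : Set (Fin n →₀ ℕ)}
    (hP : IsUpperSet P) : Nonempty (StanleyPartition P) := by
  induction n with
  | zero =>
    by_cases h : (0 : Fin 0 →₀ ℕ) ∈ P
    · obtain ⟨D, -⟩ := exists_stanleyPartition_of_fintype (P := P) (ι := Unit)
        (fun _ => 0) (fun _ => ∅)
        (fun w => by simp [Subsingleton.elim w 0, h, base_mem_stanleySet])
        (fun _ _ _ _ _ => rfl)
      exact ⟨D⟩
    · obtain ⟨D, -⟩ := exists_stanleyPartition_of_fintype (P := P) (ι := Empty)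
        (fun _ => 0) (fun _ => ∅)
        (fun w => by simp [Subsingleton.elim w 0, h]) (fun i => i.elim)
      exact ⟨D⟩
  | succ n ih =>
    obtain ⟨N, hN⟩ := hP.exists_expSnoc_stable
    have hslice (b : ℕ) : IsUpperSet {c | expSnoc c b ∈ P} := fun c d hcd hc =>
      hP (le_iff_expInit_le_and_last_le.2 (by simpa using hcd)) hc
    let D (b : ℕ) : StanleyPartition {c | expSnoc c b ∈ P} := (ih (hslice b)).some
    let Z (b : ℕ) (i : Fin (D b).r) : Set (Fin (n + 1)) :=
      {k | (∃ j ∈ (D b).vars i, k = j.castSucc) ∨ (k = Fin.last n ∧ b = N)}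
    have hZ (b : ℕ) (i : Fin (D b).r) : Fin.castSucc ⁻¹' Z b i = (D b).vars i := by
      ext j
      simp [Z]
    have hmem (b : ℕ) (i : Fin (D b).r) (w : Fin (n + 1) →₀ ℕ) (hb : b ≤ N) :
        w ∈ stanleySet (expSnoc ((D b).base i) b) (Z b i) ↔
          expInit w ∈ stanleySet ((D b).base i) ((D b).vars i) ∧ b = min N (w (Fin.last n)) := by
      rw [mem_stanleySet_iff_expInit, hZ, expInit_expSnoc, expSnoc_last]
      refine and_congr_right fun _ => ?_
      have : Fin.last n ∈ Z b i ↔ b = N := by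
        simp [Z, (Fin.castSucc_lt_last _).ne']
      rw [this]
      omega
    refine (exists_stanleyPartition_of_fintype (P := P)
      (ι := Σ b : Fin (N + 1), Fin (D b).r)
      (fun x => expSnoc ((D x.1).base x.2) x.1) (fun x => Z x.1 x.2) ?_ ?_).nonempty
    · intro w
      have key : w ∈ P ↔ expSnoc (expInit w) (min N (w (Fin.last n))) ∈ P := by
        constructor
        · intro hw
          rw [← expSnoc_expInit w] at hw
          rcases min_cases N (w (Fin.last n)) with h | h
          · rw [h.1]
            exact hN _ _ hw
          · rwa [h.1]
        · refine fun h => hP ?_ h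
          rw [le_iff_expInit_le_and_last_le]
          simp
      rw [key]
      refine ((D (min N (w (Fin.last n)))).mem_iff (expInit w)).trans ⟨?_, ?_⟩
      · rintro ⟨i, hi⟩
        exact ⟨⟨⟨min N (w (Fin.last n)), by omega⟩, i⟩,
          (hmem _ i w (min_le_left _ _)).2 ⟨hi, rfl⟩⟩
      · rintro ⟨⟨⟨b, hb⟩, i⟩, hi⟩
        obtain ⟨hi, rfl⟩ := (hmem b i w (by omega)).1 hi
        exact ⟨i, hi⟩
    · rintro ⟨⟨b, hb⟩, i⟩ ⟨⟨b', hb'⟩, i'⟩ w hi hj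
      obtain ⟨hi, rfl⟩ := (hmem b i w (by omega)).1 hi
      obtain ⟨hj, rfl⟩ := (hmem b' i' w (by omega)).1 hj
      rw [(D _).eq_of_mem hi hj]

theorem slength_expInit_mem_or_last_pos {P : Set (Fin n →₀ ℕ)} (hP : IsUpperSet P)
    (h0 : (0 : Fin n →₀ ℕ) ∉ P) :
    slength {w : Fin (n + 1) →₀ ℕ | expInit w ∈ P ∨ 1 ≤ w (Fin.last n)} = slength P + 1 := by
  obtain ⟨D, hD⟩ := hP.nonempty_stanleyPartition.some.exists_r_eq_slength
  have hmem (i : Fin D.r) (w : Fin (n + 1) →₀ ℕ) :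
      w ∈ stanleySet (expSnoc (D.base i) 0) (Fin.castSucc '' D.vars i) ↔
        expInit w ∈ stanleySet (D.base i) (D.vars i) ∧ w (Fin.last n) = 0 := by
    rw [mem_stanleySet_iff_expInit, expInit_expSnoc, expSnoc_last,
      Set.preimage_image_eq _ (Fin.castSucc_injective n)]
    simp [(Fin.castSucc_lt_last _).ne]
  have hmem' (w : Fin (n + 1) →₀ ℕ) :
      w ∈ stanleySet (expSnoc 0 1) Set.univ ↔ 1 ≤ w (Fin.last n) := by
    rw [mem_stanleySet_iff_expInit, expInit_expSnoc, expSnoc_last]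
    simp [mem_stanleySet_iff]
  obtain ⟨E, hE⟩ := exists_stanleyPartition_of_fintype
    (P := {w : Fin (n + 1) →₀ ℕ | expInit w ∈ P ∨ 1 ≤ w (Fin.last n)})
    (ι := Option (Fin D.r))
    (fun x => x.elim (expSnoc 0 1) fun i => expSnoc (D.base i) 0)
    (fun x => x.elim Set.univ fun i => Fin.castSucc '' D.vars i)
    (by
      intro w
      simp only [Set.mem_ofPred_eq, Option.exists, Option.elim_none, Option.elim_some, hmem, hmem',
        exists_and_right, ← D.mem_iff]
      by_cases h : w (Fin.last n) = 0
      · simp [h]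
      · simp [h, Nat.one_le_iff_ne_zero])
    (by
      rintro (_ | i) (_ | j) w hi hj <;>
        simp only [Option.elim_none, Option.elim_some, hmem, hmem'] at hi hj
      · rfl
      · omega
      · omega
      · rw [D.eq_of_mem hi.1 hj.1])
  apply le_antisymm
  · have := E.slength_le
    simp only [Fintype.card_option, Fintype.card_fin] at hE
    omega
  · obtain ⟨F, hF⟩ := E.exists_r_eq_slength
    obtain ⟨k, hk⟩ := (F.mem_iff (expSnoc 0 1)).1 (by simp)
    have hk1 : F.base k (Fin.last n) ≠ 0 := by
      intro hlast
      have hle := le_iff_expInit_le_and_last_le.1 (mem_stanleySet_iff.1 hk).1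
      have hbase := (F.mem_iff _).2 ⟨k, base_mem_stanleySet (F.base k) (F.vars k)⟩
      rw [expInit_expSnoc, nonpos_iff_eq_zero] at hle
      simp [hle.1, hlast, h0] at hbase
    have hslice (i : Fin F.r) (c : Fin n →₀ ℕ) :
        expSnoc c 0 ∈ stanleySet (F.base i) (F.vars i) ↔
          F.base i (Fin.last n) = 0 ∧
            c ∈ stanleySet (expInit (F.base i)) (Fin.castSucc ⁻¹' F.vars i) := by
      rw [mem_stanleySet_iff_expInit, expInit_expSnoc, expSnoc_last]
      constructor
      · rintro ⟨h, h', -⟩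
        exact ⟨by omega, h⟩
      · rintro ⟨h, h'⟩
        exact ⟨h', by omega, fun _ => h.symm⟩
    obtain ⟨G, hG⟩ := exists_stanleyPartition_of_fintype (P := P)
      (ι := {i : Fin F.r // F.base i (Fin.last n) = 0})
      (fun i => expInit (F.base i)) (fun i => Fin.castSucc ⁻¹' F.vars i)
      (by
        intro c
        have := F.mem_iff (expSnoc c 0)
        simp only [hslice] at this
        simpa using this)
      (by
        rintro ⟨i, hi⟩ ⟨j, hj⟩ c hci hcj
        exact Subtype.ext (F.eq_of_mem ((hslice i c).2 ⟨hi, hci⟩) ((hslice j c).2 ⟨hj, hcj⟩)))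
    have hlt := Fintype.card_subtype_lt (p := fun i => F.base i (Fin.last n) = 0) hk1
    rw [Fintype.card_fin] at hlt
    have := G.slength_le
    omega

end Exponents

theorem isUpperSet_monSet {σ K : Type} [Field K] (I : Ideal (MvPolynomial σ K)) :
    IsUpperSet (monSet I) := by
  intro c d hcd hc
  have : (monomial d (1 : K) : MvPolynomial σ K) = monomial (d - c) 1 * monomial c 1 := by
    rw [monomial_mul, one_mul, tsub_add_cancel_of_le hcd]
  change monomial d (1 : K) ∈ I
  rw [this]
  exact I.mul_mem_left _ hc

theorem mem_monSet_span_monomial {σ K : Type} [Field K] {A : Set (σ →₀ ℕ)} {d : σ →₀ ℕ} :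
    d ∈ monSet (Ideal.span ((fun d => (monomial d (1 : K) : MvPolynomial σ K)) '' A)) ↔
      ∃ a ∈ A, a ≤ d := by
  classical
  simp [monSet, mem_ideal_span_monomial_image, support_monomial]

theorem monSet_map_rename_sup_span_X {K : Type} [Field K] {n : ℕ}
    {I' : Ideal (MvPolynomial (Fin n) K)} (hmon : IsMonomialIdeal I') :
    monSet (Ideal.map (MvPolynomial.rename (Fin.castSucc : Fin n → Fin (n + 1))) I' ⊔
      Ideal.span {(MvPolynomial.X (Fin.last n) : MvPolynomial (Fin (n + 1)) K)}) =
    {w | expInit w ∈ monSet I' ∨ 1 ≤ w (Fin.last n)} := by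
  obtain ⟨A, rfl⟩ := hmon
  have hspan : Ideal.map (MvPolynomial.rename (Fin.castSucc : Fin n → Fin (n + 1)))
        (Ideal.span ((fun d => (monomial d (1 : K))) '' A)) ⊔
        Ideal.span {(MvPolynomial.X (Fin.last n) : MvPolynomial (Fin (n + 1)) K)} =
      Ideal.span ((fun d => (monomial d (1 : K))) ''
        (Finsupp.mapDomain Fin.castSucc '' A ∪ {Finsupp.single (Fin.last n) 1})) := by
    rw [Ideal.map_span, ← Ideal.span_union, Set.image_union, Set.image_image, Set.image_image,
      Set.image_singleton]
    simp only [rename_monomial]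
    rfl
  have hmap (a : Fin n →₀ ℕ) : Finsupp.mapDomain Fin.castSucc a = expSnoc a 0 := by
    ext i
    induction i using Fin.lastCases with
    | last =>
      rw [Finsupp.mapDomain_of_notMem_range _ _ (by simp), expSnoc_last]
    | cast i => rw [Finsupp.mapDomain_apply (Fin.castSucc_injective n), expSnoc_castSucc]
  ext w
  rw [hspan, mem_monSet_span_monomial, Set.mem_ofPred_eq, mem_monSet_span_monomial]
  simp only [Set.mem_union, or_and_right, exists_or, Set.exists_mem_image, hmap,
    le_iff_expInit_le_and_last_le (v := expSnoc _ _), expInit_expSnoc, expSnoc_last, zero_le,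
    and_true, Set.mem_singleton_iff, exists_eq_left, Finsupp.single_le_iff]

/-- If `I' ⊂ S' = K[x_1,…,x_n]` is a nonzero proper monomial
ideal and `I = (I', x_{n+1}) ⊂ S = K[x_1,…,x_{n+1}]`, then
`slength(I) = slength(I') + 1`. -/
theorem stmt_14 {K : Type} [Field K] {n : ℕ} (I' : Ideal (MvPolynomial (Fin n) K))
    (hmon : IsMonomialIdeal I') (hne : I' ≠ ⊥) (hprop : I' ≠ ⊤) :
    slength (monSet (Ideal.map
        (MvPolynomial.rename (Fin.castSucc : Fin n → Fin (n + 1))) I' ⊔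
      Ideal.span {(MvPolynomial.X (Fin.last n) : MvPolynomial (Fin (n + 1)) K)})) =
    slength (monSet I') + 1 := by
  rw [monSet_map_rename_sup_span_X hmon]
  refine slength_expInit_mem_or_last_pos (isUpperSet_monSet I') fun h => hprop ?_
  exact (Ideal.eq_top_iff_one I').2 h
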